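/- arXiv:1709.08083 — 2 statements merged into one kernel-verified Lean document; each statement's English description precedes it below -/
import Mathlib

section
/- (Pattern anti-monotonicity.) Let G be a database network, α ≥ 0, and let p1 ⊆ p2 ⊆ S be patterns. Then: (1) if the maximal pattern truss C*_{p2}(α) in G_{p2} is nonempty, then the maximal pattern truss C*_{p1}(α) in G_{p1} is nonempty; and (2) if C*_{p1}(α) is empty, then C*_{p2}(α) is empty. -/
open Finset

attribute [local instance] Classical.propDecidable

variable {V S : Type*}

/-- The frequency of pattern `p` in transaction database `d`. -/
noncomputable def freqIn [DecidableEq S] (d : Multiset (Finset S)) (p : Finset S) : ℚ :=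
  ((d.filter (fun t => p ⊆ t)).card : ℚ) / (d.card : ℚ)

/-- Vertex set of the theme network `G_p`: vertices with positive frequency of `p`. -/
noncomputable def themeVerts [Fintype V] [DecidableEq S]
    (db : V → Multiset (Finset S)) (p : Finset S) : Finset V :=
  univ.filter (fun v => 0 < freqIn (db v) p)

/-- Edge set of the theme network `G_p`: edges of `G` both of whose endpoints have
positive frequency of `p`. -/
noncomputable def themeEdges [Fintype V] [DecidableEq V] [DecidableEq S]
    (G : SimpleGraph V) [DecidableRel G.Adj]
    (db : V → Multiset (Finset S)) (p : Finset S) : Finset (Sym2 V) :=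
  G.edgeFinset.filter (fun e => ∀ v ∈ e, 0 < freqIn (db v) p)

/-- Vertices of the edge-induced subgraph with edge set `E'`. -/
noncomputable def edgeVerts [Fintype V] [DecidableEq V] (E' : Finset (Sym2 V)) : Finset V :=
  univ.filter (fun v => ∃ e ∈ E', v ∈ e)

/-- Edge cohesion of the edge `(i, j)` in the edge-induced subgraph with edge set `E'`,
with vertex frequencies `f`: the sum over triangles containing the edge of the minimum
frequency of the three vertices of the triangle. -/
noncomputable def eco [Fintype V] [DecidableEq V]
    (E' : Finset (Sym2 V)) (f : V → ℚ) (i j : V) : ℚ :=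
  ∑ k ∈ univ.filter (fun k => k ≠ i ∧ k ≠ j ∧ s(i, k) ∈ E' ∧ s(j, k) ∈ E'),
    min (f i) (min (f j) (f k))

/-- A pattern truss w.r.t. threshold `α`: an edge-induced subgraph of the theme network
`G_p` each of whose edges has cohesion greater than `α`. -/
def IsPatternTruss [Fintype V] [DecidableEq V] [DecidableEq S]
    (G : SimpleGraph V) [DecidableRel G.Adj]
    (db : V → Multiset (Finset S)) (p : Finset S) (α : ℚ)
    (E' : Finset (Sym2 V)) : Prop :=
  E' ⊆ themeEdges G db p ∧
  ∀ i j : V, s(i, j) ∈ E' → α < eco E' (fun v => freqIn (db v) p) i j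

/-- The (edge set of the) maximal pattern truss `C*_p(α)`: the union of all pattern
trusses with respect to `α` in `G_p`. -/
noncomputable def maxTruss [Fintype V] [DecidableEq V] [DecidableEq S]
    (G : SimpleGraph V) [DecidableRel G.Adj]
    (db : V → Multiset (Finset S)) (p : Finset S) (α : ℚ) : Finset (Sym2 V) :=
  univ.filter (fun e => ∃ E' : Finset (Sym2 V), IsPatternTruss G db p α E' ∧ e ∈ E')

theorem freqIn_anti [DecidableEq S] (d : Multiset (Finset S)) {p1 p2 : Finset S}
    (h : p1 ⊆ p2) : freqIn d p2 ≤ freqIn d p1 := by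
  unfold freqIn
  have : (d.filter (fun t => p2 ⊆ t)).card ≤ (d.filter (fun t => p1 ⊆ t)).card :=
    Multiset.card_le_card (Multiset.monotone_filter_right d (fun t ht => h.trans ht))
  gcongr

theorem maxTruss_anti [Fintype V] [DecidableEq V] [DecidableEq S]
    (G : SimpleGraph V) [DecidableRel G.Adj]
    (db : V → Multiset (Finset S)) (α : ℚ) {p1 p2 : Finset S} (h12 : p1 ⊆ p2) :
    maxTruss G db p2 α ⊆ maxTruss G db p1 α := by
  intro e he
  simp only [maxTruss, mem_filter, mem_univ, true_and] at he ⊢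
  obtain ⟨E', ⟨hs, hc⟩, heE⟩ := he
  refine ⟨E', ⟨?_, ?_⟩, heE⟩
  · intro x hx
    have := hs hx
    simp only [themeEdges, mem_filter] at this ⊢
    exact ⟨this.1, fun v hv => (this.2 v hv).trans_le (freqIn_anti _ h12)⟩
  · intro i j hij
    refine (hc i j hij).trans_le ?_
    unfold eco
    refine Finset.sum_le_sum fun k _ => ?_
    exact min_le_min (freqIn_anti _ h12) (min_le_min (freqIn_anti _ h12) (freqIn_anti _ h12))

/-- Pattern anti-monotonicity: if `p1 ⊆ p2`, then (1) if the maximal pattern truss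
`C*_{p2}(α)` is nonempty then `C*_{p1}(α)` is nonempty, and (2) if `C*_{p1}(α)` is
empty then `C*_{p2}(α)` is empty. -/
theorem maxTruss_pattern_anti_monotone [Fintype V] [DecidableEq V] [DecidableEq S]
    (G : SimpleGraph V) [DecidableRel G.Adj]
    (db : V → Multiset (Finset S)) (hdb : ∀ v, db v ≠ 0)
    (α : ℚ) (hα : 0 ≤ α)
    (p1 p2 : Finset S) (h12 : p1 ⊆ p2) :
    (maxTruss G db p2 α ≠ ∅ → maxTruss G db p1 α ≠ ∅) ∧
    (maxTruss G db p1 α = ∅ → maxTruss G db p2 α = ∅) := by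
  have h := maxTruss_anti G db α h12
  refine ⟨fun h2 h1 => h2 ?_, fun h1 => ?_⟩ <;>
  · rw [h1] at h
    exact Finset.subset_empty.mp h
end

section
/- (Decomposition theorem.) Let G_p be a theme network, let α1 ≥ 0 be such that the maximal pattern truss C*_p(α1) is nonempty, and let β = min over edges e_ij ∈ E*_p(α1) of eco_ij(C*_p(α1)) be its minimum edge cohesion. If α2 ≥ β, then C*_p(α2) is a proper subgraph of C*_p(α1): C*_p(α2) ⊆ C*_p(α1) and C*_p(α2) ≠ C*_p(α1). -/
open Finset

attribute [local instance] Classical.propDecidable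

variable {V S : Type*}

theorem eco_mono_aux [Fintype V] [DecidableEq V] (A B : Finset (Sym2 V)) (h : A ⊆ B)
    (f : V → ℚ) (hf : ∀ v, 0 ≤ f v) (i j : V) : eco A f i j ≤ eco B f i j := by
  unfold eco
  apply Finset.sum_le_sum_of_subset_of_nonneg
  · intro k hk
    simp only [Finset.mem_filter, Finset.mem_univ, true_and] at hk ⊢
    exact ⟨hk.1, hk.2.1, h hk.2.2.1, h hk.2.2.2⟩
  · intro k _ _
    exact le_min (hf i) (le_min (hf j) (hf k))

theorem maxTruss_eco_aux [Fintype V] [DecidableEq V] [DecidableEq S]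
    (G : SimpleGraph V) [DecidableRel G.Adj]
    (db : V → Multiset (Finset S)) (p : Finset S) (α : ℚ) (i j : V)
    (h : s(i, j) ∈ maxTruss G db p α) :
    α < eco (maxTruss G db p α) (fun v => freqIn (db v) p) i j := by
  have h0 := h
  simp only [maxTruss, Finset.mem_filter, Finset.mem_univ, true_and] at h0
  obtain ⟨E', hE, he⟩ := h0
  refine lt_of_lt_of_le (hE.2 i j he) (eco_mono_aux _ _ ?_ _ ?_ i j)
  · intro e he'
    simp only [maxTruss, Finset.mem_filter, Finset.mem_univ, true_and]
    exact ⟨E', hE, he'⟩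
  · intro v
    simp only [freqIn]
    positivity

/-- Decomposition theorem: if `C*_p(α1)` is nonempty with minimum edge cohesion `β`,
and `α2 ≥ β`, then `C*_p(α2)` is a proper subgraph of `C*_p(α1)`. -/
theorem maxTruss_proper_shrink [Fintype V] [DecidableEq V] [DecidableEq S]
    (G : SimpleGraph V) [DecidableRel G.Adj]
    (db : V → Multiset (Finset S)) (hdb : ∀ v, db v ≠ 0)
    (p : Finset S) (α1 α2 : ℚ) (hα1 : 0 ≤ α1)
    (hne : maxTruss G db p α1 ≠ ∅)
    (β : ℚ)
    (hβ_le : ∀ i j : V, s(i, j) ∈ maxTruss G db p α1 →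
      β ≤ eco (maxTruss G db p α1) (fun v => freqIn (db v) p) i j)
    (hβ_mem : ∃ i j : V, s(i, j) ∈ maxTruss G db p α1 ∧
      eco (maxTruss G db p α1) (fun v => freqIn (db v) p) i j = β)
    (hα2 : β ≤ α2) :
    maxTruss G db p α2 ⊆ maxTruss G db p α1 ∧
    maxTruss G db p α2 ≠ maxTruss G db p α1 := by
  obtain ⟨i, j, hij, hb⟩ := hβ_mem
  have h1 := maxTruss_eco_aux G db p α1 i j hij
  constructor
  · intro e he
    simp only [maxTruss, Finset.mem_filter, Finset.mem_univ, true_and] at he ⊢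
    obtain ⟨E', hE, he⟩ := he
    refine ⟨E', ⟨hE.1, fun a b hab => lt_trans ?_ (hE.2 a b hab)⟩, he⟩
    linarith
  · intro heq
    have h2 := maxTruss_eco_aux G db p α2 i j (heq ▸ hij)
    rw [heq] at h2
    linarith
end
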